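/- For every natural number n there exists a bijection RS from the set M_n of perfect matchings of [2n] to the set OT(∅,2n) of oscillating tableaux of shape ∅ and length 2n such that for every matching M, the Dyck word D_M of M equals the Dyck word D_{RS(M)} of the oscillating tableau RS(M). -/

import Mathlib

/-- `ν` covers `μ` in Young's lattice: the Young diagram of `ν` is obtained from that of `μ`
by adding one box. -/
def YCov (μ ν : YoungDiagram) : Prop := μ ≤ ν ∧ ν.card = μ.card + 1

/-- `T` is an oscillating tableau of shape `lam` and length `l`: a sequence
`(λ⁰, λ¹, …, λˡ)` of partitions with `λ⁰ = ∅`, `λˡ = lam`, and consecutive terms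
differing by adding or removing a single box. -/
def IsOscTab (lam : YoungDiagram) (l : ℕ) (T : Fin (l + 1) → YoungDiagram) : Prop :=
  T 0 = ⊥ ∧ T (Fin.last l) = lam ∧
    ∀ i : Fin l, YCov (T i.castSucc) (T i.succ) ∨ YCov (T i.succ) (T i.castSucc)

/-- The set `OT(lam, l)` of oscillating tableaux of shape `lam` and length `l`. -/
def OscTab (lam : YoungDiagram) (l : ℕ) := {T : Fin (l + 1) → YoungDiagram // IsOscTab lam l T}

/-- `M` is a perfect matching of `{1, …, 2n}` (modeled on `Fin (2 * n)`):
a partition of the ground set into pairs. -/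
def IsPerfectMatching (n : ℕ) (M : Finset (Finset (Fin (2 * n)))) : Prop :=
  (∀ p ∈ M, p.card = 2) ∧ ∀ i : Fin (2 * n), ∃! p, p ∈ M ∧ i ∈ p

/-- The Dyck word `D_M` of a matching `M`: the `i`-th letter is `true` (= 1) iff `i` is an
opener of `M` (the smaller element of its pair). -/
def matchDyck (n : ℕ) (M : Finset (Finset (Fin (2 * n)))) : Fin (2 * n) → Bool :=
  fun i => decide (∃ p ∈ M, i ∈ p ∧ ∃ j ∈ p, i < j)

/-- The Dyck word `D_T` of an oscillating tableau `T` of empty shape and length `2n`: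
the `i`-th letter is `true` (= 1) iff the `i`-th step of `T` adds a box. -/
def tabDyck (n : ℕ) (T : OscTab ⊥ (2 * n)) : Fin (2 * n) → Bool :=
  fun i => decide ((T.1 i.castSucc).card < (T.1 i.succ).card)

namespace YoungDiagram

theorem yCov_iff_insert {μ ν : YoungDiagram} :
    YCov μ ν ↔ ∃ c, c ∉ μ ∧ ν.cells = insert c μ.cells := by
  constructor
  · rintro ⟨hle, hcard⟩
    obtain ⟨c, hc⟩ := Finset.card_eq_one.1
      (show (ν.cells \ μ.cells).card = 1 by
        rw [Finset.card_sdiff_of_subset (cells_subset_iff.2 hle)]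
        simp only [YoungDiagram.card] at hcard
        omega)
    have hmem : c ∈ ν.cells \ μ.cells := by simp [hc]
    refine ⟨c, fun h => (Finset.mem_sdiff.1 hmem).2 (mem_cells c |>.2 h), ?_⟩
    rw [← Finset.sdiff_union_of_subset (cells_subset_iff.2 hle), hc]
    rfl
  · rintro ⟨c, hc, h⟩
    refine ⟨cells_subset_iff.1 (h ▸ Finset.subset_insert _ _), ?_⟩
    simp only [YoungDiagram.card]
    rw [h, Finset.card_insert_of_notMem (by simpa using hc)]

/-- Row `i` can be extended by a box. -/
def IsAddable (μ : YoungDiagram) (i : ℕ) : Prop := i = 0 ∨ μ.rowLen i < μ.rowLen (i - 1)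

/-- The last box of row `i` can be removed. -/
def IsRemovable (μ : YoungDiagram) (i : ℕ) : Prop := μ.rowLen (i + 1) < μ.rowLen i

/-- Extend row `i` by a box, when possible. -/
noncomputable def addBox (μ : YoungDiagram) (i : ℕ) : YoungDiagram :=
  open scoped Classical in
  if h : μ.IsAddable i then
    { cells := insert (i, μ.rowLen i) μ.cells
      isLowerSet := by
        rintro ⟨a, b⟩ ⟨c, d⟩ ⟨hca, hdb⟩ hab
        simp only at hca hdb
        simp only [Finset.coe_insert, Set.mem_insert_iff, Prod.mk.injEq, Finset.mem_coe,
          mem_cells, mem_iff_lt_rowLen] at hab ⊢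
        rcases hab with ⟨rfl, rfl⟩ | hab
        · rcases Nat.eq_or_lt_of_le hca with rfl | hlt
          · omega
          · have := μ.rowLen_anti c (a - 1) (by omega)
            rcases h with h | h <;> omega
        · have := μ.rowLen_anti c a hca
          omega }
  else μ

/-- Remove the last box of row `i`, when possible. -/
noncomputable def removeBox (μ : YoungDiagram) (i : ℕ) : YoungDiagram :=
  open scoped Classical in
  if h : μ.IsRemovable i then
    { cells := μ.cells.erase (i, μ.rowLen i - 1)
      isLowerSet := by
        rintro ⟨a, b⟩ ⟨c, d⟩ ⟨hca, hdb⟩ hab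
        simp only at hca hdb
        simp only [Finset.coe_erase, Set.mem_sdiff, Set.mem_singleton_iff, Prod.mk.injEq,
          Finset.mem_coe, mem_cells, mem_iff_lt_rowLen, not_and] at hab ⊢
        have h1 := μ.rowLen_anti c a hca
        refine ⟨by omega, ?_⟩
        rintro rfl rfl
        unfold IsRemovable at h
        rcases Nat.eq_or_lt_of_le hca with rfl | hlt
        · exact hab.2 rfl (by omega)
        · have := μ.rowLen_anti (c + 1) a hlt
          omega }
  else μ

theorem cells_addBox {μ : YoungDiagram} {i : ℕ} (h : μ.IsAddable i) :
    (μ.addBox i).cells = insert (i, μ.rowLen i) μ.cells := by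
  simp [addBox, h]

theorem cells_removeBox {μ : YoungDiagram} {i : ℕ} (h : μ.IsRemovable i) :
    (μ.removeBox i).cells = μ.cells.erase (i, μ.rowLen i - 1) := by
  simp [removeBox, h]

open scoped Classical in
/-- The rows that can be extended by a box. -/
noncomputable def addableRows (μ : YoungDiagram) : Finset ℕ :=
  (Finset.range (μ.colLen 0 + 1)).filter μ.IsAddable

open scoped Classical in
/-- The rows whose last box can be removed. -/
noncomputable def removableRows (μ : YoungDiagram) : Finset ℕ :=
  (Finset.range (μ.colLen 0)).filter μ.IsRemovable

theorem mem_addableRows {μ : YoungDiagram} {i : ℕ} : i ∈ μ.addableRows ↔ μ.IsAddable i := by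
  simp only [addableRows, Finset.mem_filter, Finset.mem_range, and_iff_right_iff_imp]
  rintro (rfl | h)
  · omega
  · have : (i - 1, 0) ∈ μ := mem_iff_lt_rowLen.2 (by omega)
    rw [mem_iff_lt_colLen] at this
    omega

theorem mem_removableRows {μ : YoungDiagram} {i : ℕ} :
    i ∈ μ.removableRows ↔ μ.IsRemovable i := by
  simp only [removableRows, Finset.mem_filter, Finset.mem_range, and_iff_right_iff_imp]
  intro h
  unfold IsRemovable at h
  rw [← mem_iff_lt_colLen, mem_iff_lt_rowLen]
  omega

theorem card_addableRows (μ : YoungDiagram) :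
    μ.addableRows.card = μ.removableRows.card + 1 := by
  classical
  rw [addableRows, removableRows, Finset.card_filter, Finset.card_filter,
    Finset.sum_range_succ']
  congr 1
  · exact Finset.sum_congr rfl fun i _ =>
      if_congr (by simp [IsAddable, IsRemovable]) rfl rfl
  · simp [IsAddable]

/-- The diagrams covering `μ`. -/
noncomputable def upperCovers (μ : YoungDiagram) : Finset YoungDiagram :=
  open scoped Classical in μ.addableRows.image μ.addBox

/-- The diagrams covered by `μ`. -/
noncomputable def lowerCovers (μ : YoungDiagram) : Finset YoungDiagram :=
  open scoped Classical in μ.removableRows.image μ.removeBox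

theorem mem_upperCovers {μ ν : YoungDiagram} : ν ∈ μ.upperCovers ↔ YCov μ ν := by
  simp only [upperCovers, Finset.mem_image, mem_addableRows, yCov_iff_insert]
  constructor
  · rintro ⟨i, hi, rfl⟩
    exact ⟨_, by simp [mem_iff_lt_rowLen], cells_addBox hi⟩
  · rintro ⟨⟨i, j⟩, hc, h⟩
    have key : ∀ a b, (a, b) ∈ ν ↔ (a = i ∧ b = j) ∨ b < μ.rowLen a := fun a b => by
      rw [← mem_cells, h]; simp [mem_iff_lt_rowLen]
    rw [mem_iff_lt_rowLen] at hc
    have hij : (i, j) ∈ ν := by simp [key]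
    have hj : j = μ.rowLen i := by
      by_contra hne
      have := (key i (μ.rowLen i)).1 (ν.up_left_mem le_rfl (by omega) hij)
      omega
    subst hj
    have hadd : μ.IsAddable i := by
      by_cases hi : i = 0
      · exact .inl hi
      · right
        have := (key (i - 1) (μ.rowLen i)).1 (ν.up_left_mem (by omega) le_rfl hij)
        omega
    exact ⟨i, hadd, YoungDiagram.ext (by rw [cells_addBox hadd, h])⟩

theorem mem_lowerCovers {μ ν : YoungDiagram} : ν ∈ μ.lowerCovers ↔ YCov ν μ := by
  simp only [lowerCovers, Finset.mem_image, mem_removableRows, yCov_iff_insert]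
  constructor
  · rintro ⟨i, hi, rfl⟩
    refine ⟨(i, μ.rowLen i - 1), ?_, ?_⟩
    · rw [← mem_cells, cells_removeBox hi]; simp
    · rw [cells_removeBox hi, Finset.insert_erase]
      unfold IsRemovable at hi
      rw [mem_cells, mem_iff_lt_rowLen]
      omega
  · rintro ⟨⟨i, j⟩, hc, h⟩
    have key : ∀ a b, b < μ.rowLen a ↔ (a = i ∧ b = j) ∨ (a, b) ∈ ν := fun a b => by
      rw [← mem_iff_lt_rowLen, ← mem_cells, h]; simp
    have hij : j < μ.rowLen i := by simp [key]
    have hj : j = μ.rowLen i - 1 := by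
      by_contra hne
      rcases (key i (j + 1)).1 (by omega) with h' | h'
      · omega
      · exact hc (ν.up_left_mem le_rfl (by omega) h')
    have hrem : μ.IsRemovable i := by
      by_contra hne
      unfold IsRemovable at hne
      rcases (key (i + 1) j).1 (by omega) with h' | h'
      · omega
      · exact hc (ν.up_left_mem (by omega) le_rfl h')
    refine ⟨i, hrem, YoungDiagram.ext ?_⟩
    rw [cells_removeBox hrem, h, ← hj, Finset.erase_insert (by simpa using hc)]

theorem card_upperCovers (μ : YoungDiagram) :
    μ.upperCovers.card = μ.lowerCovers.card + 1 := by
  classical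
  rw [upperCovers, lowerCovers, Finset.card_image_of_injOn, Finset.card_image_of_injOn,
    card_addableRows]
  · intro i hi j hj hij
    simp only [Finset.mem_coe, mem_removableRows] at hi hj
    have h := congrArg YoungDiagram.cells hij
    rw [cells_removeBox hi, cells_removeBox hj] at h
    unfold IsRemovable at hi hj
    have h1 : (i, μ.rowLen i - 1) ∉ μ.cells.erase (j, μ.rowLen j - 1) := by simp [← h]
    simp only [Finset.mem_erase, ne_eq, Prod.mk.injEq, mem_cells, mem_iff_lt_rowLen,
      not_and, not_lt] at h1
    by_contra hne
    have := h1 (fun h => absurd h hne)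
    omega
  · intro i hi j hj hij
    simp only [Finset.mem_coe, mem_addableRows] at hi hj
    have h := congrArg YoungDiagram.cells hij
    rw [cells_addBox hi, cells_addBox hj] at h
    have h1 : (i, μ.rowLen i) ∈ insert (j, μ.rowLen j) μ.cells := by simp [← h]
    simp only [Finset.mem_insert, Prod.mk.injEq, mem_cells, mem_iff_lt_rowLen, lt_irrefl,
      or_false] at h1
    exact h1.1

theorem card_sup_add_card_inf (μ ν : YoungDiagram) :
    (μ ⊔ ν).card + (μ ⊓ ν).card = μ.card + ν.card := by
  simp only [YoungDiagram.card, cells_sup, cells_inf]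
  exact Finset.card_union_add_card_inter _ _

theorem eq_of_le_of_card_le {μ ν : YoungDiagram} (h : μ ≤ ν) (hc : ν.card ≤ μ.card) : μ = ν :=
  YoungDiagram.ext (Finset.eq_of_subset_of_card_le (cells_subset_iff.2 h) hc)

theorem YCov.sup_eq {κ ν μ : YoungDiagram} (h1 : YCov κ μ) (h2 : YCov ν μ) (hne : ν ≠ κ) :
    κ ⊔ ν = μ := by
  refine eq_of_le_of_card_le (sup_le h1.1 h2.1) ?_
  rw [h1.2, Nat.succ_le_iff]
  by_contra! hle
  have h := eq_of_le_of_card_le le_sup_left hle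
  have hcard : κ.card = ν.card := by have := h1.2; have := h2.2; omega
  exact hne (eq_of_le_of_card_le (h ▸ le_sup_right) hcard.le)

theorem YCov.inf_eq {κ ν ρ : YoungDiagram} (h1 : YCov ρ κ) (h2 : YCov ρ ν) (hne : ν ≠ κ) :
    κ ⊓ ν = ρ := by
  refine (eq_of_le_of_card_le (le_inf h1.1 h2.1) ?_).symm
  rw [← Nat.lt_succ_iff, Nat.succ_eq_add_one, ← h1.2]
  by_contra! hle
  have h := eq_of_le_of_card_le inf_le_left hle
  have hcard : κ.card = ν.card := by have := h1.2; have := h2.2; omega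
  exact hne (eq_of_le_of_card_le (inf_eq_left.1 h) hcard.ge).symm

theorem YCov.inf {κ ν μ : YoungDiagram} (h1 : YCov κ μ) (h2 : YCov ν μ) (hne : ν ≠ κ) :
    YCov (κ ⊓ ν) κ ∧ YCov (κ ⊓ ν) ν := by
  have h := card_sup_add_card_inf κ ν
  rw [YCov.sup_eq h1 h2 hne] at h
  have := h1.2
  have := h2.2
  exact ⟨⟨inf_le_left, by omega⟩, ⟨inf_le_right, by omega⟩⟩

theorem YCov.sup {κ ν ρ : YoungDiagram} (h1 : YCov ρ κ) (h2 : YCov ρ ν) (hne : ν ≠ κ) :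
    YCov κ (κ ⊔ ν) ∧ YCov ν (κ ⊔ ν) := by
  have h := card_sup_add_card_inf κ ν
  rw [YCov.inf_eq h1 h2 hne] at h
  have := h1.2
  have := h2.2
  exact ⟨⟨le_sup_left, by omega⟩, ⟨le_sup_right, by omega⟩⟩

/-- The commutation relation `DU = UD + 1` of Young's lattice as a differential poset. -/
theorem sum_upperCovers_lowerCovers (g : YoungDiagram → ℕ) (κ : YoungDiagram) :
    ∑ μ ∈ κ.upperCovers, ∑ ν ∈ μ.lowerCovers, g ν =
      g κ + ∑ ρ ∈ κ.lowerCovers, ∑ ν ∈ ρ.upperCovers, g ν := by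
  classical
  have hup : ∀ μ ∈ κ.upperCovers, ∑ ν ∈ μ.lowerCovers, g ν =
      g κ + ∑ ν ∈ μ.lowerCovers.erase κ, g ν := fun μ hμ =>
    (Finset.add_sum_erase _ _ (mem_lowerCovers.2 (mem_upperCovers.1 hμ))).symm
  have hdn : ∀ ρ ∈ κ.lowerCovers, ∑ ν ∈ ρ.upperCovers, g ν =
      g κ + ∑ ν ∈ ρ.upperCovers.erase κ, g ν := fun ρ hρ =>
    (Finset.add_sum_erase _ _ (mem_upperCovers.2 (mem_lowerCovers.1 hρ))).symm
  have hswap : ∑ μ ∈ κ.upperCovers, ∑ ν ∈ μ.lowerCovers.erase κ, g ν =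
      ∑ ρ ∈ κ.lowerCovers, ∑ ν ∈ ρ.upperCovers.erase κ, g ν := by
    rw [Finset.sum_sigma', Finset.sum_sigma']
    refine Finset.sum_bij' (fun p _ => ⟨κ ⊓ p.2, p.2⟩) (fun p _ => ⟨κ ⊔ p.2, p.2⟩) ?_ ?_ ?_ ?_
      (fun _ _ => rfl)
    all_goals
      rintro ⟨μ, ν⟩ h
      simp only [Finset.mem_sigma, Finset.mem_erase, mem_upperCovers, mem_lowerCovers] at h ⊢
      obtain ⟨h1, hne, h2⟩ := h
    · exact ⟨(YCov.inf h1 h2 hne).1, hne, (YCov.inf h1 h2 hne).2⟩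
    · exact ⟨(YCov.sup h1 h2 hne).1, hne, (YCov.sup h1 h2 hne).2⟩
    · rw [YCov.sup_eq h1 h2 hne]
    · rw [YCov.inf_eq h1 h2 hne]
  rw [Finset.sum_congr rfl hup, Finset.sum_congr rfl hdn, Finset.sum_add_distrib,
    Finset.sum_add_distrib, hswap, Finset.sum_const, Finset.sum_const, card_upperCovers,
    add_smul, one_smul]
  ring

/-- The number of standard fillings of a diagram with `k` boxes. -/
noncomputable def numSYT : ℕ → YoungDiagram → ℕ
  | 0, _ => 1
  | k + 1, μ => ∑ ν ∈ μ.lowerCovers, numSYT k ν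

theorem sum_upperCovers_numSYT (k : ℕ) {κ : YoungDiagram} (h : κ.card = k) :
    ∑ μ ∈ κ.upperCovers, numSYT (k + 1) μ = (k + 1) * numSYT k κ := by
  induction k generalizing κ with
  | zero =>
    have hempty : κ.lowerCovers = ∅ := by
      refine Finset.eq_empty_of_forall_notMem fun ν hν => ?_
      have := (mem_lowerCovers.1 hν).2
      omega
    simp only [numSYT]
    rw [sum_upperCovers_lowerCovers (fun _ => 1), hempty]
    simp
  | succ k ih =>
    have hrec (μ : YoungDiagram) (m : ℕ) : numSYT (m + 1) μ = ∑ ν ∈ μ.lowerCovers, numSYT m ν := rfl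
    simp only [hrec _ (k + 1)]
    rw [sum_upperCovers_lowerCovers, Finset.sum_congr rfl fun ρ hρ => ih
      (by have := (mem_lowerCovers.1 hρ).2; omega), ← Finset.mul_sum, ← hrec]
    ring

end YoungDiagram

namespace DyckWord

/-- The number of openers among the first `k` letters of `w`. -/
def openers (w : ℕ → Bool) (k : ℕ) : ℕ := Nat.count (fun i => w i = true) k

/-- The number of closers among the first `k` letters of `w`. -/
def closers (w : ℕ → Bool) (k : ℕ) : ℕ := Nat.count (fun i => w i = false) k

/-- The product of the heights at which the closers among the first `k` letters of `w` start. -/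
def weight (w : ℕ → Bool) : ℕ → ℕ
  | 0 => 1
  | k + 1 => if w k = true then weight w k else weight w k * (openers w k - closers w k)

theorem openers_zero (w : ℕ → Bool) : openers w 0 = 0 := Nat.count_zero _

theorem closers_zero (w : ℕ → Bool) : closers w 0 = 0 := Nat.count_zero _

theorem openers_succ (w : ℕ → Bool) (k : ℕ) :
    openers w (k + 1) = openers w k + if w k = true then 1 else 0 := Nat.count_succ _ _

theorem closers_succ (w : ℕ → Bool) (k : ℕ) :
    closers w (k + 1) = closers w k + if w k = false then 1 else 0 := Nat.count_succ _ _

theorem closers_le_openers_of_weight_ne_zero {w : ℕ → Bool} {k : ℕ} (h : weight w k ≠ 0) :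
    closers w k ≤ openers w k := by
  induction k with
  | zero => simp [closers_zero]
  | succ k ih =>
    rw [openers_succ, closers_succ]
    by_cases hw : w k = true
    · simp only [weight, hw, if_true] at h ⊢
      have := ih h
      simp
      omega
    · rw [weight, if_neg hw, mul_ne_zero_iff] at h
      rw [if_neg hw, if_pos (by simpa using hw)]
      omega

end DyckWord

namespace OscTab

open YoungDiagram DyckWord

/-- The walks of length `k` in Young's lattice from `⊥` to `κ` that go up at the letters `true`
of `w` and down at the letters `false`. -/
def walks (w : ℕ → Bool) (k : ℕ) (κ : YoungDiagram) : Set (Fin (k + 1) → YoungDiagram) :=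
  {T | T 0 = ⊥ ∧ T (Fin.last k) = κ ∧ ∀ i : Fin k,
    if w i = true then YCov (T i.castSucc) (T i.succ) else YCov (T i.succ) (T i.castSucc)}

/-- The possible positions before the step `k` of a walk with word `w` that arrives at `κ`. -/
noncomputable def predecessors (w : ℕ → Bool) (k : ℕ) (κ : YoungDiagram) : Finset YoungDiagram :=
  if w k = true then κ.lowerCovers else κ.upperCovers

theorem snoc_mem_walks {w : ℕ → Bool} {k : ℕ} {κ μ : YoungDiagram}
    {T : Fin (k + 1) → YoungDiagram} :
    (Fin.snoc T μ : Fin (k + 2) → YoungDiagram) ∈ walks w (k + 1) κ ↔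
      μ = κ ∧ T (Fin.last k) ∈ predecessors w k κ ∧ T ∈ walks w k (T (Fin.last k)) := by
  have h0 : (Fin.snoc T μ : Fin (k + 2) → YoungDiagram) 0 = T 0 :=
    Fin.snoc_castSucc (α := fun _ => YoungDiagram) μ T 0
  simp only [walks, Set.mem_ofPred_eq, Fin.forall_fin_succ', h0, Fin.snoc_last, Fin.snoc_castSucc,
    Fin.succ_castSucc, Fin.succ_last, Fin.val_castSucc, Fin.val_last, true_and]
  have hp : T (Fin.last k) ∈ predecessors w k κ ↔
      if w k = true then YCov (T (Fin.last k)) κ else YCov κ (T (Fin.last k)) := by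
    unfold predecessors
    split_ifs
    · exact mem_lowerCovers
    · exact mem_upperCovers
  rw [hp]
  constructor
  · rintro ⟨h1, rfl, h2, h3⟩
    exact ⟨rfl, h3, h1, h2⟩
  · rintro ⟨rfl, h3, h1, h2⟩
    exact ⟨h1, rfl, h2, h3⟩

theorem finite_walks_and_card_succ (w : ℕ → Bool) (k : ℕ) (κ : YoungDiagram)
    (hfin : ∀ μ, Finite (walks w k μ)) :
    Finite (walks w (k + 1) κ) ∧
      Nat.card (walks w (k + 1) κ) = ∑ μ ∈ predecessors w k κ, Nat.card (walks w k μ) := by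
  let F : (Σ μ : predecessors w k κ, walks w k μ) → walks w (k + 1) κ := fun p =>
    ⟨Fin.snoc p.2.1 κ, snoc_mem_walks.2 ⟨rfl, by
      have h := p.2.2.2.1
      exact ⟨by rw [h]; exact p.1.2, by rw [h]; exact p.2.2⟩⟩⟩
  have hF : Function.Bijective F := by
    constructor
    · rintro ⟨⟨μ, hμ⟩, T, hT⟩ ⟨⟨ν, hν⟩, S, hS⟩ h
      have h' : (Fin.snoc T κ : Fin (k + 2) → YoungDiagram) = Fin.snoc S κ :=
        congrArg Subtype.val h
      have hTS : T = S := by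
        rw [← Fin.init_snoc (α := fun _ => YoungDiagram) κ T, h', Fin.init_snoc]
      subst hTS
      obtain rfl : μ = ν := hT.2.1.symm.trans hS.2.1
      rfl
    · rintro ⟨T, hT⟩
      rw [← Fin.snoc_init_self T] at hT
      obtain ⟨h1, h2, h3⟩ := snoc_mem_walks.1 hT
      refine ⟨⟨⟨_, h2⟩, _, h3⟩, Subtype.ext ?_⟩
      change Fin.snoc (Fin.init T) κ = T
      rw [← h1, Fin.snoc_init_self]
  refine ⟨Finite.of_surjective F hF.2, ?_⟩
  rw [← Nat.card_congr (Equiv.ofBijective F hF), Nat.card_sigma]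
  exact Finset.sum_coe_sort (predecessors w k κ) fun μ => Nat.card (walks w k μ)

theorem finite_walks (w : ℕ → Bool) (k : ℕ) (κ : YoungDiagram) : Finite (walks w k κ) := by
  induction k generalizing κ with
  | zero =>
    refine Set.Finite.subset (Set.finite_singleton fun _ => ⊥) fun T hT => ?_
    funext i
    rw [Fin.fin_one_eq_zero i]
    exact hT.1
  | succ k ih => exact (finite_walks_and_card_succ w k κ ih).1

theorem card_walks (w : ℕ → Bool) (k : ℕ) (κ : YoungDiagram) :
    Nat.card (walks w k κ) =
      if κ.card + closers w k = openers w k then weight w k * numSYT κ.card κ else 0 := by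
  induction k generalizing κ with
  | zero =>
    have hcard : κ.card = 0 ↔ κ = ⊥ := by
      rw [YoungDiagram.card, Finset.card_eq_zero, ← cells_bot, YoungDiagram.ext_iff]
    simp only [weight, one_mul]
    split_ifs with h <;> rw [closers_zero, openers_zero, add_zero, hcard] at h
    · subst h
      rw [hcard.2 rfl, numSYT, Nat.card_eq_one_iff_unique]
      refine ⟨⟨fun S T => Subtype.ext (funext fun i => ?_)⟩, ⟨⟨fun _ => ⊥, rfl, rfl, nofun⟩⟩⟩
      rw [Fin.fin_one_eq_zero i, S.2.1, T.2.1]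
    · have : IsEmpty (walks w 0 κ) := ⟨fun T => h (T.2.2.1.symm.trans T.2.1)⟩
      exact Nat.card_of_isEmpty
  | succ k ih =>
    rw [(finite_walks_and_card_succ w k κ (finite_walks w k)).2]
    simp only [ih, openers_succ, closers_succ, weight, predecessors]
    by_cases hw : w k = true
    · simp only [hw, if_true, Bool.true_eq_false, if_false, add_zero]
      rcases hκ : κ.card with _ | m
      · have hempty : κ.lowerCovers = ∅ := by
          refine Finset.eq_empty_of_forall_notMem fun ν hν => ?_
          have := (mem_lowerCovers.1 hν).2
          omega
        rw [hempty, Finset.sum_empty]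
        split_ifs with h
        · by_contra hne
          have := closers_le_openers_of_weight_ne_zero (w := w) (k := k)
            (fun h0 => hne (by rw [h0, zero_mul]))
          omega
        · rfl
      · have hμ : ∀ μ ∈ κ.lowerCovers, μ.card = m := fun μ hμ => by
          have := (mem_lowerCovers.1 hμ).2
          omega
        rw [Finset.sum_congr rfl fun μ h => by rw [hμ μ h]]
        split_ifs with h1 h2 h2
        · rw [← Finset.mul_sum]; rfl
        · omega
        · omega
        · simp
    · have hμ : ∀ μ ∈ κ.upperCovers, μ.card = κ.card + 1 := fun μ hμ =>
        (mem_upperCovers.1 hμ).2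
      rw [Bool.not_eq_true] at hw
      simp only [hw, if_true, Bool.false_eq_true, if_false, add_zero]
      rw [Finset.sum_congr rfl fun μ h => by rw [hμ μ h]]
      split_ifs with h1 h2 h2
      · rw [← Finset.mul_sum, sum_upperCovers_numSYT _ rfl, ← h1, mul_assoc]
        congr 2
        omega
      · omega
      · omega
      · simp

theorem nonempty_fiber_tabDyck_equiv_walks (n : ℕ) (w : ℕ → Bool) :
    Nonempty ({T : OscTab ⊥ (2 * n) // tabDyck n T = fun i : Fin (2 * n) => w i} ≃ walks w (2 * n) ⊥) := by
  have key : ∀ T : Fin (2 * n + 1) → YoungDiagram, ∀ i : Fin (2 * n),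
      ((YCov (T i.castSucc) (T i.succ) ∨ YCov (T i.succ) (T i.castSucc)) ∧
        decide ((T i.castSucc).card < (T i.succ).card) = w i) ↔
      if w i = true then YCov (T i.castSucc) (T i.succ)
        else YCov (T i.succ) (T i.castSucc) := by
    intro T i
    cases hw : w i
    · simp only [decide_eq_false_iff_not, Bool.false_eq_true, if_false]
      constructor
      · rintro ⟨h | h, h'⟩
        · have := h.2
          omega
        · exact h
      · intro h
        have := h.2
        exact ⟨.inr h, by omega⟩
    · simp only [decide_eq_true_iff, if_true]
      constructor
      · rintro ⟨h | h, h'⟩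
        · exact h
        · have := h.2
          omega
      · intro h
        have := h.2
        exact ⟨.inl h, by omega⟩
  exact ⟨{
    toFun := fun T => ⟨T.1.1, T.1.2.1, T.1.2.2.1, fun i =>
      (key T.1.1 i).1 ⟨T.1.2.2.2 i, congrFun T.2 i⟩⟩
    invFun := fun T => ⟨⟨T.1, T.2.1, T.2.2.1, fun i => ((key T.1 i).2 (T.2.2.2 i)).1⟩,
      funext fun i => ((key T.1 i).2 (T.2.2.2 i)).2⟩
    left_inv := fun _ => rfl
    right_inv := fun _ => rfl }⟩

end OscTab

namespace IsPerfectMatching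

open DyckWord

/-- The maps on `Fin k` that fix the openers of `w` and send its closers injectively to
smaller openers. -/
def closerMaps (w : ℕ → Bool) (k : ℕ) : Set (Fin k → ℕ) :=
  {f | (∀ i : Fin k, w i = true → f i = i) ∧
    (∀ i : Fin k, w i = false → f i < i ∧ w (f i) = true) ∧
    ∀ i j : Fin k, w i = false → w j = false → f i = f j → i = j}

/-- The values of `f` at the closers of `w`. -/
def closerImage (w : ℕ → Bool) (k : ℕ) (f : Fin k → ℕ) : Finset ℕ :=
  (Finset.univ.filter fun i : Fin k => w i = false).image f

/-- The possible values at `k` of an extension of `f` to a closer map on `Fin (k + 1)`. -/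
def allowedValues (w : ℕ → Bool) (k : ℕ) (f : Fin k → ℕ) : Finset ℕ :=
  if w k = true then {k}
  else ((Finset.range k).filter fun i => w i = true) \ closerImage w k f

theorem snoc_mem_closerMaps {w : ℕ → Bool} {k x : ℕ} {f : Fin k → ℕ} :
    (Fin.snoc f x : Fin (k + 1) → ℕ) ∈ closerMaps w (k + 1) ↔
      f ∈ closerMaps w k ∧ x ∈ allowedValues w k f := by
  simp only [closerMaps, Set.mem_ofPred_eq, Fin.forall_fin_succ', Fin.snoc_last,
    Fin.snoc_castSucc, Fin.val_castSucc, Fin.val_last, Fin.castSucc_inj]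
  by_cases hw : w k = true
  · simp [allowedValues, hw]
    tauto
  · rw [Bool.not_eq_true] at hw
    simp only [allowedValues, closerImage, hw, Bool.false_eq_true, if_false, Finset.mem_sdiff,
      Finset.mem_filter, Finset.mem_range, Finset.mem_image, Finset.mem_univ, true_and,
      not_exists, not_and, false_imp_iff, and_true, true_imp_iff, implies_true,
      (Fin.castSucc_lt_last _).ne, (Fin.castSucc_lt_last _).ne', imp_false]
    constructor
    · rintro ⟨h1, ⟨h2, h3⟩, h4, h5⟩
      exact ⟨⟨h1, h2, fun i => (h4 i).1⟩, h3, fun i => (h4 i).2⟩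
    · rintro ⟨⟨h1, h2, h4⟩, h3, h5⟩
      exact ⟨h1, ⟨h2, h3⟩, fun i => ⟨h4 i, h5 i⟩, fun i hi h => h5 i hi h.symm⟩

theorem card_filter_range_openers (w : ℕ → Bool) (k : ℕ) :
    ((Finset.range k).filter fun i => w i = true).card = openers w k :=
  (Nat.count_eq_card_filter_range _ _).symm

theorem closerImage_subset {w : ℕ → Bool} {k : ℕ} {f : Fin k → ℕ} (hf : f ∈ closerMaps w k) :
    closerImage w k f ⊆ (Finset.range k).filter fun i => w i = true := by
  intro x hx
  simp only [closerImage, Finset.mem_image, Finset.mem_filter, Finset.mem_univ, true_and] at hx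
  obtain ⟨i, hi, rfl⟩ := hx
  have := hf.2.1 i hi
  exact Finset.mem_filter.2 ⟨Finset.mem_range.2 (this.1.trans i.2), this.2⟩

theorem card_closerImage {w : ℕ → Bool} {k : ℕ} {f : Fin k → ℕ} (hf : f ∈ closerMaps w k) :
    (closerImage w k f).card = closers w k := by
  rw [closerImage, Finset.card_image_of_injOn, closers, Nat.count_eq_card_filter_range,
    Finset.card_filter, Finset.card_filter,
    Fin.sum_univ_eq_sum_range (fun i => if w i = false then 1 else 0) k]
  intro i hi j hj h
  simp only [Finset.coe_filter, Finset.mem_univ, true_and, Set.mem_ofPred_eq] at hi hj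
  exact hf.2.2 i j hi hj h

theorem card_allowedValues {w : ℕ → Bool} {k : ℕ} {f : Fin k → ℕ} (hf : f ∈ closerMaps w k) :
    (allowedValues w k f).card = if w k = true then 1 else openers w k - closers w k := by
  unfold allowedValues
  split_ifs
  · rfl
  · rw [Finset.card_sdiff_of_subset (closerImage_subset hf), card_filter_range_openers,
      card_closerImage hf]

theorem finite_closerMaps_and_card (w : ℕ → Bool) (k : ℕ) :
    Finite (closerMaps w k) ∧ Nat.card (closerMaps w k) = weight w k := by
  induction k with
  | zero =>
    refine ⟨inferInstance, Nat.card_eq_one_iff_unique.2 ⟨inferInstance, ?_⟩⟩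
    exact ⟨⟨nofun, nofun, nofun, nofun⟩⟩
  | succ k ih =>
    obtain ⟨hfin, hcard⟩ := ih
    let F : (Σ f : closerMaps w k, allowedValues w k f.1) → closerMaps w (k + 1) := fun p =>
      ⟨Fin.snoc p.1.1 p.2.1, snoc_mem_closerMaps.2 ⟨p.1.2, p.2.2⟩⟩
    have hF : Function.Bijective F := by
      constructor
      · rintro ⟨⟨f, hf⟩, x, hx⟩ ⟨⟨g, hg⟩, y, hy⟩ h
        have h' : (Fin.snoc f x : Fin (k + 1) → ℕ) = Fin.snoc g y := congrArg Subtype.val h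
        have hxy : x = y := by simpa using congrFun h' (Fin.last k)
        have hfg : f = g := by
          rw [← Fin.init_snoc (α := fun _ => ℕ) x f, h', Fin.init_snoc]
        subst hxy hfg
        rfl
      · rintro ⟨f, hf⟩
        rw [← Fin.snoc_init_self f] at hf
        obtain ⟨h1, h2⟩ := snoc_mem_closerMaps.1 hf
        exact ⟨⟨⟨_, h1⟩, _, h2⟩, Subtype.ext (Fin.snoc_init_self f)⟩
    refine ⟨Finite.of_surjective F hF.2, ?_⟩
    have := Fintype.ofFinite (closerMaps w k)
    rw [← Nat.card_congr (Equiv.ofBijective F hF), Nat.card_sigma]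
    simp only [Nat.card_eq_fintype_card, Fintype.card_coe]
    rw [Finset.sum_congr rfl fun f _ => card_allowedValues f.2, Finset.sum_const,
      Finset.card_univ, ← Nat.card_eq_fintype_card, hcard, weight]
    split_ifs <;> simp

variable {n : ℕ} {M : Finset (Finset (Fin (2 * n)))}

/-- The pair of a perfect matching that contains `i`. -/
noncomputable def block (hM : IsPerfectMatching n M) (i : Fin (2 * n)) : Finset (Fin (2 * n)) :=
  (hM.2 i).choose

theorem block_mem (hM : IsPerfectMatching n M) (i : Fin (2 * n)) : hM.block i ∈ M :=
  (hM.2 i).choose_spec.1.1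

theorem mem_block (hM : IsPerfectMatching n M) (i : Fin (2 * n)) : i ∈ hM.block i :=
  (hM.2 i).choose_spec.1.2

theorem eq_block (hM : IsPerfectMatching n M) {i : Fin (2 * n)} {p : Finset (Fin (2 * n))}
    (hp : p ∈ M) (hi : i ∈ p) : p = hM.block i :=
  (hM.2 i).choose_spec.2 p ⟨hp, hi⟩

/-- The smaller element of the pair containing `i`. -/
noncomputable def minBlock (hM : IsPerfectMatching n M) (i : Fin (2 * n)) : Fin (2 * n) :=
  (hM.block i).min' ⟨i, hM.mem_block i⟩

theorem minBlock_mem (hM : IsPerfectMatching n M) (i : Fin (2 * n)) :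
    hM.minBlock i ∈ hM.block i := Finset.min'_mem _ _

theorem minBlock_le (hM : IsPerfectMatching n M) {i j : Fin (2 * n)} (h : j ∈ hM.block i) :
    hM.minBlock i ≤ j := Finset.min'_le _ _ h

theorem mem_block_iff_minBlock_eq (hM : IsPerfectMatching n M) {i j : Fin (2 * n)} :
    j ∈ hM.block i ↔ hM.minBlock j = hM.minBlock i := by
  constructor
  · intro h
    have := hM.eq_block (hM.block_mem i) h
    simp only [minBlock, this]
  · intro h
    have h1 := hM.eq_block (hM.block_mem j) (hM.minBlock_mem j)
    rw [h, ← hM.eq_block (hM.block_mem i) (hM.minBlock_mem i)] at h1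
    exact h1 ▸ hM.mem_block j

theorem matchDyck_eq_true_iff_exists (hM : IsPerfectMatching n M) (i : Fin (2 * n)) :
    matchDyck n M i = true ↔ ∃ j ∈ hM.block i, i < j := by
  simp only [matchDyck, decide_eq_true_iff]
  constructor
  · rintro ⟨p, hp, hi, j, hj, hij⟩
    exact ⟨j, hM.eq_block hp hi ▸ hj, hij⟩
  · rintro ⟨j, hj, hij⟩
    exact ⟨_, hM.block_mem i, hM.mem_block i, j, hj, hij⟩

theorem eq_of_mem_block (hM : IsPerfectMatching n M) {i a b c : Fin (2 * n)}
    (ha : a ∈ hM.block i) (hb : b ∈ hM.block i) (hc : c ∈ hM.block i)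
    (hac : a ≠ c) (hbc : b ≠ c) : a = b := by
  by_contra hab
  have := Finset.two_lt_card.2 ⟨a, ha, b, hb, c, hc, hab, hac, hbc⟩
  rw [hM.1 _ (hM.block_mem i)] at this
  omega

theorem matchDyck_eq_true_iff (hM : IsPerfectMatching n M) (i : Fin (2 * n)) :
    matchDyck n M i = true ↔ hM.minBlock i = i := by
  rw [matchDyck_eq_true_iff_exists hM]
  have hle := hM.minBlock_le (hM.mem_block i)
  constructor
  · rintro ⟨j, hj, hij⟩
    by_contra hne
    exact hij.ne (hM.eq_of_mem_block (hM.mem_block i) hj (hM.minBlock_mem i) (Ne.symm hne)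
      (hle.trans_lt hij).ne')
  · intro h
    obtain ⟨j, hj, hne⟩ := Finset.exists_mem_ne
      (by rw [hM.1 _ (hM.block_mem i)]; omega : 1 < (hM.block i).card) i
    exact ⟨j, hj, lt_of_le_of_ne (h ▸ hM.minBlock_le hj) hne.symm⟩

theorem minBlock_minBlock (hM : IsPerfectMatching n M) (i : Fin (2 * n)) :
    hM.minBlock (hM.minBlock i) = hM.minBlock i :=
  hM.mem_block_iff_minBlock_eq.1 (hM.minBlock_mem i)

theorem minBlock_mem_closerMaps (hM : IsPerfectMatching n M) {w : ℕ → Bool}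
    (hw : matchDyck n M = fun i : Fin (2 * n) => w i) :
    (fun i => (hM.minBlock i : ℕ)) ∈ closerMaps w (2 * n) := by
  have hiff : ∀ i : Fin (2 * n), w i = true ↔ hM.minBlock i = i := fun i => by
    rw [← matchDyck_eq_true_iff hM, hw]
  have hne : ∀ i : Fin (2 * n), w i = false → i ≠ hM.minBlock i := fun i hi h => by
    rw [(hiff i).2 h.symm] at hi
    cases hi
  refine ⟨fun i hi => congrArg Fin.val ((hiff i).1 hi), fun i hi => ⟨?_, ?_⟩,
    fun i j hi hj hij => ?_⟩
  · exact Fin.lt_def.1 (lt_of_le_of_ne (hM.minBlock_le (hM.mem_block i)) (hne i hi).symm)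
  · exact (hiff _).2 (hM.minBlock_minBlock i)
  · have hij' := Fin.ext hij
    exact hM.eq_of_mem_block (hM.mem_block i) (hM.mem_block_iff_minBlock_eq.2 hij'.symm)
      (hM.minBlock_mem i) (hne i hi) (hij' ▸ hne j hj)

theorem openers_eq_closers (hM : IsPerfectMatching n M) {w : ℕ → Bool}
    (hw : matchDyck n M = fun i : Fin (2 * n) => w i) :
    openers w (2 * n) = closers w (2 * n) := by
  have hf := hM.minBlock_mem_closerMaps hw
  rw [← card_closerImage hf, ← card_filter_range_openers]
  congr 1
  refine Finset.Subset.antisymm (fun x hx => ?_) (closerImage_subset hf)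
  simp only [Finset.mem_filter, Finset.mem_range] at hx
  have hop : matchDyck n M ⟨x, hx.1⟩ = true := by rw [hw]; exact hx.2
  obtain ⟨j, hj, hlt⟩ := (hM.matchDyck_eq_true_iff_exists _).1 hop
  have hmin := hM.mem_block_iff_minBlock_eq.1 hj
  rw [(hM.matchDyck_eq_true_iff _).1 hop] at hmin
  simp only [closerImage, Finset.mem_image, Finset.mem_filter, Finset.mem_univ, true_and]
  refine ⟨j, ?_, by rw [hmin]⟩
  by_contra hne
  have hop_j : matchDyck n M j = true := by rw [hw]; simpa using hne
  rw [hM.matchDyck_eq_true_iff, hmin] at hop_j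
  exact hlt.ne hop_j

/-- The set partition of `Fin (2 * n)` into the fibers of `f`. -/
def ofCloserMap (f : Fin (2 * n) → ℕ) : Finset (Finset (Fin (2 * n))) :=
  Finset.univ.image fun i => Finset.univ.filter fun j => f j = f i

theorem eq_ofCloserMap (hM : IsPerfectMatching n M) :
    M = ofCloserMap fun i => (hM.minBlock i : ℕ) := by
  have hblock : ∀ i, hM.block i =
      Finset.univ.filter fun j => (hM.minBlock j : ℕ) = (hM.minBlock i : ℕ) := fun i => by
    ext j
    simp [mem_block_iff_minBlock_eq, Fin.ext_iff]
  ext p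
  simp only [ofCloserMap, Finset.mem_image, Finset.mem_univ, true_and, ← hblock]
  constructor
  · intro hp
    obtain ⟨i, hi⟩ := Finset.card_pos.1 (by rw [hM.1 p hp]; omega : 0 < p.card)
    exact ⟨i, (hM.eq_block hp hi).symm⟩
  · rintro ⟨i, rfl⟩
    exact hM.block_mem i

theorem exists_closer_of_opener {w : ℕ → Bool} {k : ℕ} {f : Fin k → ℕ}
    (hf : f ∈ closerMaps w k) (hw : openers w k = closers w k) {o : Fin k} (ho : w o = true) :
    ∃ c : Fin k, w c = false ∧ f c = o := by
  have h := Finset.eq_of_subset_of_card_le (closerImage_subset hf)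
    (by rw [card_closerImage hf, card_filter_range_openers, hw])
  have hmem : (o : ℕ) ∈ closerImage w k f := by simp [h, ho]
  simpa [closerImage] using hmem

theorem exists_opener {w : ℕ → Bool} {k : ℕ} {f : Fin k → ℕ} (hf : f ∈ closerMaps w k)
    (i : Fin k) : ∃ o : Fin k, w o = true ∧ f i = o ∧ f o = o ∧ o ≤ i := by
  cases hi : w i
  · have h := hf.2.1 i hi
    exact ⟨⟨f i, h.1.trans i.2⟩, h.2, rfl, hf.1 _ h.2, h.1.le⟩
  · exact ⟨i, hi, hf.1 i hi, hf.1 i hi, le_rfl⟩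

theorem isPerfectMatching_ofCloserMap {w : ℕ → Bool} {f : Fin (2 * n) → ℕ}
    (hf : f ∈ closerMaps w (2 * n)) (hw : openers w (2 * n) = closers w (2 * n)) :
    IsPerfectMatching n (ofCloserMap f) := by
  simp only [IsPerfectMatching, ofCloserMap, Finset.mem_image, Finset.mem_univ, true_and,
    forall_exists_index, forall_apply_eq_imp_iff]
  refine ⟨fun i => ?_, fun i => ⟨_, ⟨⟨i, rfl⟩, by simp⟩, ?_⟩⟩
  · obtain ⟨o, ho, hio, hoo, -⟩ := exists_opener hf i
    obtain ⟨c, hc, hco⟩ := exists_closer_of_opener hf hw ho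
    have hne : o ≠ c := by
      rintro rfl
      rw [ho] at hc
      cases hc
    refine (congrArg Finset.card ?_).trans (Finset.card_pair hne)
    ext j
    simp only [Finset.mem_filter, Finset.mem_univ, true_and, Finset.mem_insert,
      Finset.mem_singleton, hio]
    constructor
    · intro h
      cases hj : w j
      · exact .inr (hf.2.2 j c hj hc (h.trans hco.symm))
      · exact .inl (Fin.ext ((hf.1 j hj).symm.trans h))
    · rintro (rfl | rfl)
      · exact hoo
      · exact hco
  · rintro _ ⟨⟨k, rfl⟩, hk⟩
    simp only [Finset.mem_filter, Finset.mem_univ, true_and] at hk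
    simp only [hk]

theorem block_ofCloserMap {f : Fin (2 * n) → ℕ} (hM : IsPerfectMatching n (ofCloserMap f))
    (i : Fin (2 * n)) : hM.block i = Finset.univ.filter fun j => f j = f i :=
  (hM.eq_block (Finset.mem_image_of_mem _ (Finset.mem_univ i)) (by simp)).symm

theorem minBlock_ofCloserMap {w : ℕ → Bool} {f : Fin (2 * n) → ℕ}
    (hf : f ∈ closerMaps w (2 * n)) (hM : IsPerfectMatching n (ofCloserMap f))
    (i : Fin (2 * n)) : (hM.minBlock i : ℕ) = f i := by
  obtain ⟨o, -, hio, hoo, -⟩ := exists_opener hf i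
  obtain ⟨o', -, hio', -, hle⟩ := exists_opener hf (hM.minBlock i)
  have h := hM.minBlock_mem i
  rw [block_ofCloserMap, Finset.mem_filter] at h
  have ho : o ∈ hM.block i := by
    rw [block_ofCloserMap]
    simp [hio, hoo]
  have h1 : (hM.minBlock i : ℕ) ≤ o := hM.minBlock_le ho
  have h2 : (o' : ℕ) ≤ hM.minBlock i := hle
  have := h.2
  omega

theorem matchDyck_ofCloserMap {w : ℕ → Bool} {f : Fin (2 * n) → ℕ}
    (hf : f ∈ closerMaps w (2 * n)) (hM : IsPerfectMatching n (ofCloserMap f)) :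
    matchDyck n (ofCloserMap f) = fun i : Fin (2 * n) => w i := by
  funext i
  rw [Bool.eq_iff_iff, matchDyck_eq_true_iff hM, Fin.ext_iff, minBlock_ofCloserMap hf]
  cases hi : w i
  · have := (hf.2.1 i hi).1
    simp
    omega
  · simp [hf.1 i hi]

theorem card_fiber_matchDyck (n : ℕ) (w : ℕ → Bool) :
    Nat.card {M : {M : Finset (Finset (Fin (2 * n))) // IsPerfectMatching n M} //
      matchDyck n M.1 = fun i : Fin (2 * n) => w i} =
      if closers w (2 * n) = openers w (2 * n) then weight w (2 * n) else 0 := by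
  split_ifs with h
  · rw [← (finite_closerMaps_and_card w (2 * n)).2]
    refine Nat.card_congr
      { toFun := fun M => ⟨_, M.1.2.minBlock_mem_closerMaps M.2⟩
        invFun := fun f => ⟨⟨_, isPerfectMatching_ofCloserMap f.2 h.symm⟩,
          matchDyck_ofCloserMap f.2 (isPerfectMatching_ofCloserMap f.2 h.symm)⟩
        left_inv := fun M => Subtype.ext (Subtype.ext M.1.2.eq_ofCloserMap.symm)
        right_inv := fun f => Subtype.ext (funext fun i => minBlock_ofCloserMap f.2
          (isPerfectMatching_ofCloserMap f.2 h.symm) i) }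
  · have : IsEmpty {M : {M : Finset (Finset (Fin (2 * n))) // IsPerfectMatching n M} //
        matchDyck n M.1 = fun i : Fin (2 * n) => w i} :=
      ⟨fun M => h (M.1.2.openers_eq_closers M.2).symm⟩
    exact Nat.card_of_isEmpty

end IsPerfectMatching

/-- **Theorem 4 (the bijection `RS`).**  For every `n` there is a bijection
`RS : M_n ≃ OT(∅, 2n)` such that `D_M = D_{RS(M)}` for all `M ∈ M_n`. -/
theorem exists_RS_bijection (n : ℕ) :
    ∃ RS : {M : Finset (Finset (Fin (2 * n))) // IsPerfectMatching n M} ≃ OscTab ⊥ (2 * n),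
      ∀ M, matchDyck n M.1 = tabDyck n (RS M) := by
  have hfiber : ∀ d : Fin (2 * n) → Bool, Nonempty
      ({M : {M : Finset (Finset (Fin (2 * n))) // IsPerfectMatching n M} // matchDyck n M.1 = d} ≃
        {T : OscTab ⊥ (2 * n) // tabDyck n T = d}) := by
    intro d
    obtain ⟨w, rfl⟩ : ∃ w : ℕ → Bool, (fun i : Fin (2 * n) => w i) = d :=
      ⟨fun k => if h : k < 2 * n then d ⟨k, h⟩ else false, funext fun i => by simp⟩
    obtain ⟨e⟩ := OscTab.nonempty_fiber_tabDyck_equiv_walks n w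
    have hfin : Finite {T : OscTab ⊥ (2 * n) // tabDyck n T = fun i : Fin (2 * n) => w i} :=
      have := OscTab.finite_walks w (2 * n) ⊥
      Finite.of_equiv _ e.symm
    refine Finite.card_eq.1 ?_
    rw [IsPerfectMatching.card_fiber_matchDyck, Nat.card_congr e, OscTab.card_walks]
    simp [YoungDiagram.card, YoungDiagram.numSYT]
  let E := fun d => Classical.choice (hfiber d)
  let RS := ((Equiv.sigmaFiberEquiv fun M : {M : Finset (Finset (Fin (2 * n))) //
    IsPerfectMatching n M} => matchDyck n M.1).symm.trans (Equiv.sigmaCongrRight E)).trans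
      (Equiv.sigmaFiberEquiv (tabDyck n))
  exact ⟨RS, fun M => (E (matchDyck n M.1) ⟨M, rfl⟩).2.symm⟩
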